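/- arXiv:2206.00319 — 3 statements merged into one kernel-verified Lean document; each statement's English description precedes it below -/
import Mathlib

section
/- (Contraction of kernel compositions under two-sided density bounds) Let E be a measurable space with a measure μ, let m ≥ 1, and let b_1, …, b_m : E × E → ℝ≥0 be measurable functions such that for each i and each x ∈ E, y ↦ b_i(x, y) is a probability density with respect to μ, and such that σ₋ ≤ b_i(x, y) ≤ σ₊ for all i, x, y, where 0 < σ₋ ≤ σ₊ < ∞. Define the composition of the associated Markov kernels on bounded measurable h : E → ℝ by (K_1⋯K_m h)(x) = ∫ ⋯ ∫ h(y_m) b_1(x, y_1) b_2(y_1, y_2) ⋯ b_m(y_{m−1}, y_m) dμ(y_1)⋯dμ(y_m). Then for every bounded measurable h and all x, x' ∈ E: |(K_1⋯K_m h)(x) − (K_1⋯K_m h)(x')| ≤ (1 − σ₋/σ₊)^m · (sup h − inf h). -/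
open MeasureTheory Finset

/-- The chain `(x, y_1, …, y_m)`: position `0` is the starting point `x` and
position `j ≥ 1` is `y_j`. -/
def chainPt {E : Type*} {m : ℕ} (x : E) (y : Fin m → E) (j : ℕ) : E :=
  if j = 0 then x else if hj : j - 1 < m then y ⟨j - 1, hj⟩ else x

theorem measurable_chainPt {E : Type*} [MeasurableSpace E] {m : ℕ} (x : E) (j : ℕ) :
    Measurable fun y : Fin m → E => chainPt x y j := by
  unfold chainPt
  split_ifs
  · exact measurable_const
  · exact measurable_pi_apply _
  · exact measurable_const

theorem chainPt_insertNth_last_of_le {E : Type*} {m : ℕ} (x z : E) (y : Fin m → E) {j : ℕ}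
    (hj : j ≤ m) :
    chainPt x (Fin.insertNth (α := fun _ => E) (Fin.last m) z y) j = chainPt x y j := by
  unfold chainPt
  rcases Nat.eq_zero_or_pos j with rfl | hpos
  · simp
  · have h1 : j - 1 < m := by omega
    have h2 : j - 1 < m + 1 := by omega
    have h3 : (⟨j - 1, h2⟩ : Fin (m + 1)) = (Fin.last m).succAbove ⟨j - 1, h1⟩ := by
      simp [Fin.succAbove_last]
    rw [if_neg hpos.ne', if_neg hpos.ne', dif_pos h2, dif_pos h1, h3,
      Fin.insertNth_apply_succAbove (α := fun _ => E)]

theorem chainPt_insertNth_last_succ {E : Type*} {m : ℕ} (x z : E) (y : Fin m → E) :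
    chainPt x (Fin.insertNth (α := fun _ => E) (Fin.last m) z y) (m + 1) = z := by
  have h3 : (⟨m, Nat.lt_succ_self m⟩ : Fin (m + 1)) = Fin.last m := rfl
  simp only [chainPt, Nat.add_eq_zero_iff, one_ne_zero, and_false, if_false, Nat.add_sub_cancel,
    Nat.lt_succ_self, dif_pos, h3]
  exact Fin.insertNth_apply_same (α := fun _ => E) _ _ _

/-- The integrand of a composition of bounded kernels against a bounded function is integrable. -/
theorem integrable_chain {E : Type*} [MeasurableSpace E] (μ : Measure E) [IsFiniteMeasure μ]
    (m : ℕ) (b : ℕ → E → E → ℝ) (hbmeas : ∀ i, Measurable (Function.uncurry (b i)))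
    (C D : ℝ) (hb : ∀ i < m, ∀ x y, |b i x y| ≤ C)
    (h : E → ℝ) (hhmeas : Measurable h) (hh : ∀ x, |h x| ≤ D) (x : E) :
    Integrable (fun y : Fin m → E => h (chainPt x y m) *
      ∏ i ∈ range m, b i (chainPt x y i) (chainPt x y (i + 1)))
      (Measure.pi fun _ : Fin m => μ) := by
  refine Integrable.of_bound (C := D * C ^ m) ?_ (ae_of_all _ fun y => ?_)
  · refine Measurable.aestronglyMeasurable ?_
    refine (hhmeas.comp (measurable_chainPt x m)).mul (Finset.measurable_fun_prod _ fun i _ => ?_)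
    exact (hbmeas i).comp ((measurable_chainPt x i).prodMk (measurable_chainPt x (i + 1)))
  · rw [Real.norm_eq_abs, abs_mul, Finset.abs_prod]
    refine mul_le_mul (hh _) ?_ (Finset.prod_nonneg fun _ _ => abs_nonneg _)
      ((abs_nonneg _).trans (hh x))
    calc ∏ i ∈ range m, |b i (chainPt x y i) (chainPt x y (i + 1))|
        ≤ ∏ _i ∈ range m, C := Finset.prod_le_prod (fun _ _ => abs_nonneg _)
          fun i hi => hb i (Finset.mem_range.1 hi) _ _
      _ = C ^ m := by simp

/-- A composition of `m + 1` kernels applies the first `m` kernels to the image of `h` under the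
last one. -/
theorem integral_chain_succ {E : Type*} [MeasurableSpace E] (μ : Measure E) [IsFiniteMeasure μ]
    (m : ℕ) (b : ℕ → E → E → ℝ) (hbmeas : ∀ i, Measurable (Function.uncurry (b i)))
    (C D : ℝ) (hb : ∀ i < m + 1, ∀ x y, |b i x y| ≤ C)
    (h : E → ℝ) (hhmeas : Measurable h) (hh : ∀ x, |h x| ≤ D) (x : E) :
    ∫ y : Fin (m + 1) → E, h (chainPt x y (m + 1)) *
        ∏ i ∈ range (m + 1), b i (chainPt x y i) (chainPt x y (i + 1))
        ∂(Measure.pi fun _ : Fin (m + 1) => μ) =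
      ∫ y : Fin m → E, (∫ z, h z * b m (chainPt x y m) z ∂μ) *
        ∏ i ∈ range m, b i (chainPt x y i) (chainPt x y (i + 1))
        ∂(Measure.pi fun _ : Fin m => μ) := by
  have mp := (measurePreserving_piFinSuccAbove (fun _ : Fin (m + 1) => μ) (Fin.last m)).symm
  have hintegrable := integrable_chain μ (m + 1) b hbmeas C D hb h hhmeas hh x
  rw [← mp.integral_comp (MeasurableEquiv.measurableEmbedding _), integral_prod_symm]
  · refine integral_congr_ae (ae_of_all _ fun y => ?_)
    dsimp only
    rw [← integral_mul_const]
    refine integral_congr_ae (ae_of_all _ fun z => ?_)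
    have he : (MeasurableEquiv.piFinSuccAbove (fun _ => E) (Fin.last m)).symm (z, y) =
      Fin.insertNth (α := fun _ => E) (Fin.last m) z y := rfl
    dsimp only
    rw [he, chainPt_insertNth_last_succ, Finset.prod_range_succ, chainPt_insertNth_last_succ,
      chainPt_insertNth_last_of_le x z y le_rfl]
    have hprod : ∀ i ∈ range m,
        b i (chainPt x (Fin.insertNth (α := fun _ => E) (Fin.last m) z y) i)
          (chainPt x (Fin.insertNth (α := fun _ => E) (Fin.last m) z y) (i + 1)) =
        b i (chainPt x y i) (chainPt x y (i + 1)) := fun i hi => by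
      have := Finset.mem_range.1 hi
      rw [chainPt_insertNth_last_of_le x z y (by omega),
        chainPt_insertNth_last_of_le x z y (by omega)]
    rw [Finset.prod_congr rfl hprod]
    ring
  · exact (mp.integrable_comp_emb (MeasurableEquiv.measurableEmbedding _)).2 hintegrable

/-- If two probability densities satisfy `ε p ≤ q`, then the `p`- and `q`-means of a function
with values in `[lo, hi]` differ by at most `(1 - ε) (hi - lo)`. -/
theorem integral_sub_integral_le_of_mul_le {E : Type*} [MeasurableSpace E] {μ : Measure E}
    {p q h : E → ℝ} {ε lo hi : ℝ} (hp : ∫ y, p y ∂μ = 1) (hq : ∫ y, q y ∂μ = 1)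
    (hp0 : ∀ y, 0 ≤ p y) (hε : ε ≤ 1) (hpq : ∀ y, ε * p y ≤ q y)
    (hh : Measurable h) (hlo : ∀ y, lo ≤ h y) (hhi : ∀ y, h y ≤ hi) :
    ∫ y, h y * q y ∂μ - ∫ y, h y * p y ∂μ ≤ (1 - ε) * (hi - lo) := by
  have ip : Integrable p μ := .of_integral_ne_zero (by simp [hp])
  have iq : Integrable q μ := .of_integral_ne_zero (by simp [hq])
  have hb : ∀ y, ‖h y‖ ≤ max |lo| |hi| := fun y => abs_le_max_abs_abs (hlo y) (hhi y)
  have ihp : Integrable (fun y => h y * p y) μ :=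
    ip.bdd_mul hh.aestronglyMeasurable (ae_of_all _ hb)
  have ihq : Integrable (fun y => h y * q y) μ :=
    iq.bdd_mul hh.aestronglyMeasurable (ae_of_all _ hb)
  have h1 : ∫ y, (h y * q y - ε * (h y * p y)) ∂μ ≤ ∫ y, hi * (q y - ε * p y) ∂μ :=
    integral_mono (ihq.sub (ihp.const_mul ε)) ((iq.sub (ip.const_mul ε)).const_mul hi)
      fun y => by
        have := mul_le_mul_of_nonneg_right (hhi y) (sub_nonneg.2 (hpq y))
        dsimp only
        linarith
  have h2 : ∫ y, lo * p y ∂μ ≤ ∫ y, h y * p y ∂μ :=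
    integral_mono (ip.const_mul lo) ihp fun y => mul_le_mul_of_nonneg_right (hlo y) (hp0 y)
  rw [integral_sub ihq (ihp.const_mul ε), integral_const_mul, integral_const_mul,
    integral_sub iq (ip.const_mul ε), integral_const_mul, hp, hq] at h1
  rw [integral_const_mul, hp] at h2
  nlinarith [mul_le_mul_of_nonneg_left h2 (sub_nonneg.2 hε)]

/-- The mean of a function with values in `[lo, hi]` under a probability density lies in
`[lo, hi]`. -/
theorem integral_mul_density_mem_Icc {E : Type*} [MeasurableSpace E] {μ : Measure E}
    {p h : E → ℝ} {lo hi : ℝ} (hp : ∫ y, p y ∂μ = 1) (hp0 : ∀ y, 0 ≤ p y)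
    (hh : Measurable h) (hlo : ∀ y, lo ≤ h y) (hhi : ∀ y, h y ≤ hi) :
    ∫ y, h y * p y ∂μ ∈ Set.Icc lo hi := by
  have ip : Integrable p μ := .of_integral_ne_zero (by simp [hp])
  have ihp : Integrable (fun y => h y * p y) μ :=
    ip.bdd_mul hh.aestronglyMeasurable
      (ae_of_all _ fun y => abs_le_max_abs_abs (hlo y) (hhi y))
  have h1 : ∫ y, lo * p y ∂μ ≤ ∫ y, h y * p y ∂μ :=
    integral_mono (ip.const_mul lo) ihp fun y => mul_le_mul_of_nonneg_right (hlo y) (hp0 y)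
  have h2 : ∫ y, h y * p y ∂μ ≤ ∫ y, hi * p y ∂μ :=
    integral_mono ihp (ip.const_mul hi) fun y => mul_le_mul_of_nonneg_right (hhi y) (hp0 y)
  rw [integral_const_mul, hp, mul_one] at h1 h2
  exact ⟨h1, h2⟩

/-- The contraction estimate for a finite reference measure, for any number of kernels. -/
theorem kernel_composition_contraction_of_isFiniteMeasure
    {E : Type*} [MeasurableSpace E] (μ : Measure E) [IsFiniteMeasure μ]
    (m : ℕ) (b : ℕ → E → E → ℝ) (hbmeas : ∀ i, Measurable (Function.uncurry (b i)))
    (hbprob : ∀ i < m, ∀ x, ∫ y, b i x y ∂μ = 1)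
    (σm σp : ℝ) (hσm : 0 < σm) (hσmp : σm ≤ σp)
    (hbdd : ∀ i < m, ∀ x y, σm ≤ b i x y ∧ b i x y ≤ σp)
    (h : E → ℝ) (hhmeas : Measurable h)
    (lo hi : ℝ) (hlo : ∀ x, lo ≤ h x) (hhi : ∀ x, h x ≤ hi) (x x' : E) :
    |(∫ y : Fin m → E,
        h (chainPt x y m) *
          ∏ i ∈ range m, b i (chainPt x y i) (chainPt x y (i + 1))
        ∂(Measure.pi fun _ : Fin m => μ)) -
      (∫ y : Fin m → E,
        h (chainPt x' y m) *
          ∏ i ∈ range m, b i (chainPt x' y i) (chainPt x' y (i + 1))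
        ∂(Measure.pi fun _ : Fin m => μ))| ≤
    (1 - σm / σp) ^ m * (hi - lo) := by
  have hσp : 0 < σp := hσm.trans_le hσmp
  have hε : σm / σp ≤ 1 := (div_le_one hσp).2 hσmp
  induction m generalizing h lo hi with
  | zero =>
    simp only [chainPt, if_true, Finset.range_zero, Finset.prod_empty, mul_one, pow_zero, one_mul,
      integral_const, Measure.real, Measure.pi_empty_univ, ENNReal.toReal_one, one_smul]
    rw [abs_le]
    constructor <;> linarith [hlo x, hlo x', hhi x, hhi x']
  | succ m ih =>
    have hb0 : ∀ x y, 0 ≤ b m x y := fun x y => hσm.le.trans (hbdd m m.lt_succ_self x y).1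
    have hbabs : ∀ i < m + 1, ∀ x y, |b i x y| ≤ σp := fun i hi x y => by
      rw [abs_of_pos (hσm.trans_le (hbdd i hi x y).1)]
      exact (hbdd i hi x y).2
    have hh : ∀ y, |h y| ≤ max |lo| |hi| := fun y => abs_le_max_abs_abs (hlo y) (hhi y)
    rw [integral_chain_succ μ m b hbmeas _ _ hbabs h hhmeas hh x,
      integral_chain_succ μ m b hbmeas _ _ hbabs h hhmeas hh x']
    set g : E → ℝ := fun u => ∫ z, h z * b m u z ∂μ with hg
    have hgmeas : Measurable g := by
      refine StronglyMeasurable.measurable ?_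
      refine StronglyMeasurable.integral_prod_right (f := fun u z => h z * b m u z) ?_
      exact ((hhmeas.comp measurable_snd).mul (hbmeas m)).stronglyMeasurable
    have hgmem : ∀ u, g u ∈ Set.Icc lo hi := fun u =>
      integral_mul_density_mem_Icc (hbprob m m.lt_succ_self u) (hb0 u) hhmeas hlo hhi
    have hosc : ∀ u v, g u - g v ≤ (1 - σm / σp) * (hi - lo) := fun u v => by
      refine integral_sub_integral_le_of_mul_le (hbprob m m.lt_succ_self v)
        (hbprob m m.lt_succ_self u) (hb0 v) hε (fun y => ?_) hhmeas hlo hhi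
      calc σm / σp * b m v y ≤ σm / σp * σp :=
            mul_le_mul_of_nonneg_left (hbdd m m.lt_succ_self v y).2 (by positivity)
        _ = σm := div_mul_cancel₀ _ hσp.ne'
        _ ≤ b m u y := (hbdd m m.lt_succ_self u y).1
    have hbelow : BddBelow (Set.range g) := ⟨lo, by rintro _ ⟨u, rfl⟩; exact (hgmem u).1⟩
    have : Nonempty E := ⟨x⟩
    have key := ih (fun i hi => hbprob i (hi.trans m.lt_succ_self))
      (fun i hi => hbdd i (hi.trans m.lt_succ_self)) g hgmeas (⨅ u, g u)
      ((⨅ u, g u) + (1 - σm / σp) * (hi - lo)) (fun u => ciInf_le hbelow u)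
      (fun u => sub_le_iff_le_add.1 (le_ciInf fun v => by linarith [hosc u v]))
    rw [add_sub_cancel_left, ← mul_assoc, ← pow_succ] at key
    exact key

/-- Contraction of kernel compositions under two-sided density bounds: if each `b_i` is a
Markov kernel density with `σ₋ ≤ b_i ≤ σ₊`, then the composition `K_1⋯K_m` contracts the
oscillation of a bounded measurable `h` by a factor `(1 − σ₋/σ₊)^m`. -/
theorem kernel_composition_contraction
    {E : Type*} [MeasurableSpace E] (μ : Measure E) [SigmaFinite μ]
    (m : ℕ) (hm : 1 ≤ m)
    (b : ℕ → E → E → ℝ) (hbmeas : ∀ i, Measurable (Function.uncurry (b i)))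
    (hbprob : ∀ i < m, ∀ x, ∫ y, b i x y ∂μ = 1)
    (σm σp : ℝ) (hσm : 0 < σm) (hσmp : σm ≤ σp)
    (hbdd : ∀ i < m, ∀ x y, σm ≤ b i x y ∧ b i x y ≤ σp)
    (h : E → ℝ) (hhmeas : Measurable h)
    (lo hi : ℝ) (hlo : ∀ x, lo ≤ h x) (hhi : ∀ x, h x ≤ hi) :
    ∀ x x' : E,
      |(∫ y : Fin m → E,
          h (chainPt x y m) *
            ∏ i ∈ range m, b i (chainPt x y i) (chainPt x y (i + 1))
          ∂(Measure.pi fun _ : Fin m => μ)) -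
        (∫ y : Fin m → E,
          h (chainPt x' y m) *
            ∏ i ∈ range m, b i (chainPt x' y i) (chainPt x' y (i + 1))
          ∂(Measure.pi fun _ : Fin m => μ))| ≤
      (1 - σm / σp) ^ m * (hi - lo) := by
  intro x x'
  have hintegrable : Integrable (b 0 x) μ := .of_integral_ne_zero (by simp [hbprob 0 hm x])
  have hconst : Integrable (fun _ : E => σm) μ :=
    hintegrable.mono' aestronglyMeasurable_const (ae_of_all _ fun y => by
      rw [Real.norm_eq_abs, abs_of_pos hσm]
      exact (hbdd 0 hm x y).1)
  have : IsFiniteMeasure μ := (integrable_const_iff_isFiniteMeasure hσm.ne').1 hconst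
  exact kernel_composition_contraction_of_isFiniteMeasure μ m b hbmeas hbprob σm σp hσm hσmp
    hbdd h hhmeas lo hi hlo hhi x x'
end

section
/- (Minorization of the forward smoothing kernels) Let E be a measurable space with a finite nonzero measure μ, let n ≥ 1, and let q_0, …, q_{n−1} : E × E → ℝ≥0 be measurable with σ₋ ≤ q_ℓ(x, x') ≤ σ₊ for all ℓ, x, x', where 0 < σ₋ ≤ σ₊ < ∞. For 0 ≤ ℓ ≤ n−1 define U_{ℓ,n}1(x) = ∫ ∏_{j=ℓ}^{n−1} q_j(x_j, x_{j+1}) dμ(x_{ℓ+1})⋯dμ(x_n) with x_ℓ = x (so U_{n,n}1 ≡ 1), and define the forward kernel F_ℓ acting on bounded measurable h : E → ℝ by F_ℓ h(x) = (∫ q_ℓ(x, x') h(x') U_{ℓ+1,n}1(x') dμ(x')) / U_{ℓ,n}1(x). Then for every 0 ≤ ℓ ≤ n−1, every nonnegative bounded measurable h, and every x ∈ E: F_ℓ h(x) ≥ (σ₋/σ₊) ν_ℓ h, where ν_ℓ is the probability measure given by ν_ℓ h = (∫ h(x') U_{ℓ+1,n}1(x') dμ(x')) / (∫ U_{ℓ+1,n}1(x')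 dμ(x')). In particular the Dobrushin contraction coefficient of F_ℓ is at most 1 − σ₋/σ₊. -/
open MeasureTheory Finset

/-- The trajectory `(x_ℓ, x_{ℓ+1}, …, x_n)` with `x_ℓ = x` and `x_{ℓ+j} = v_j` for
`1 ≤ j ≤ n − ℓ` (seen as a function of the absolute time index). -/
def chainFrom {E : Type*} (n ℓ : ℕ) (x : E) (v : Fin (n - ℓ) → E) (j : ℕ) : E :=
  if j ≤ ℓ then x else if hj : j - ℓ - 1 < n - ℓ then v ⟨j - ℓ - 1, hj⟩ else x

/-- `U_{ℓ,n}1(x) = ∫ ∏_{j=ℓ}^{n-1} q_j(x_j, x_{j+1}) dμ(x_{ℓ+1})⋯dμ(x_n)` with `x_ℓ = x`. -/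
noncomputable def Uone {E : Type*} [MeasurableSpace E] (μ : Measure E) (n : ℕ)
    (q : ℕ → E → E → ℝ) (ℓ : ℕ) (x : E) : ℝ :=
  ∫ v : Fin (n - ℓ) → E,
    ∏ j ∈ Ico ℓ n, q j (chainFrom n ℓ x v j) (chainFrom n ℓ x v (j + 1))
    ∂(Measure.pi fun _ => μ)

/-- The product `∏_{i<m} q_{ℓ+i}(x_i, x_{i+1})` along `x_0 = x`, `x_{i+1} = v_i`. -/
def chainWeight {E : Type*} (q : ℕ → E → E → ℝ) (m ℓ : ℕ) (x : E) (v : Fin m → E) : ℝ :=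
  ∏ i : Fin m, q (ℓ + i) ((Fin.cons x v : Fin (m + 1) → E) i.castSucc) (v i)

theorem Uone_eq_integral_chainWeight {E : Type*} [MeasurableSpace E] (μ : Measure E) (n : ℕ)
    (q : ℕ → E → E → ℝ) (ℓ : ℕ) (x : E) :
    Uone μ n q ℓ x = ∫ v, chainWeight q (n - ℓ) ℓ x v ∂(Measure.pi fun _ => μ) := by
  unfold Uone chainWeight
  congr 1 with v
  rw [Finset.prod_Ico_eq_prod_range, Finset.prod_range]
  refine Finset.prod_congr rfl fun i _ => ?_
  congr 1
  · obtain ⟨i, hi⟩ := i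
    cases i with
    | zero => simp [chainFrom]
    | succ k =>
      have hk : k < n - ℓ := by omega
      have h2 : (Fin.castSucc ⟨k + 1, hi⟩ : Fin (n - ℓ + 1)) = Fin.succ ⟨k, hk⟩ := rfl
      rw [h2, Fin.cons_succ]
      simp [chainFrom, hk]
  · have h3 : ℓ + (i : ℕ) + 1 - ℓ - 1 = i := by omega
    have h4 : ¬ (ℓ + (i : ℕ) + 1 ≤ ℓ) := by omega
    simp [chainFrom, h3, h4]

theorem chainWeight_cons {E : Type*} (q : ℕ → E → E → ℝ) (m ℓ : ℕ) (x y : E) (w : Fin m → E) :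
    chainWeight q (m + 1) ℓ x (Fin.cons y w) = q ℓ x y * chainWeight q m (ℓ + 1) y w := by
  unfold chainWeight
  rw [Fin.prod_univ_succ]
  simp [add_assoc, add_comm 1]

theorem measurable_chainWeight {E : Type*} [MeasurableSpace E] {q : ℕ → E → E → ℝ}
    (hq : ∀ j, Measurable (Function.uncurry (q j))) (m ℓ : ℕ) :
    Measurable fun p : E × (Fin m → E) => chainWeight q m ℓ p.1 p.2 := by
  unfold chainWeight
  refine Finset.measurable_prod _ fun i _ => ?_
  have hcons : Measurable fun p : E × (Fin m → E) =>
      (Fin.cons p.1 p.2 : Fin (m + 1) → E) i.castSucc := by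
    refine Fin.cases ?_ (fun j => ?_) i.castSucc
    · simpa using measurable_fst
    · simp only [Fin.cons_succ]
      exact (measurable_pi_apply j).comp measurable_snd
  exact (hq _).comp (hcons.prodMk ((measurable_pi_apply i).comp measurable_snd))

section Bounds

variable {E : Type*} {q : ℕ → E → E → ℝ} {n m ℓ : ℕ} {a b : ℝ}

theorem pow_le_chainWeight (ha : 0 ≤ a) (hq : ∀ j < n, ∀ x x', a ≤ q j x x') (hm : ℓ + m ≤ n)
    (x : E) (v : Fin m → E) : a ^ m ≤ chainWeight q m ℓ x v := by
  simpa [chainWeight] using Finset.prod_le_prod (s := univ) (f := fun _ : Fin m => a)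
    (fun _ _ => ha) fun i _ => hq (ℓ + i) (by omega) ((Fin.cons x v : Fin (m + 1) → E) i.castSucc) (v i)

theorem chainWeight_le_pow (hq : ∀ j < n, ∀ x x', 0 ≤ q j x x' ∧ q j x x' ≤ b) (hm : ℓ + m ≤ n)
    (x : E) (v : Fin m → E) : chainWeight q m ℓ x v ≤ b ^ m := by
  simpa [chainWeight] using Finset.prod_le_prod (s := univ) (g := fun _ : Fin m => b)
    (fun i _ => (hq (ℓ + i) (by omega) ((Fin.cons x v : Fin (m + 1) → E) i.castSucc) (v i)).1)
    fun i _ => (hq (ℓ + i) (by omega) _ _).2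

theorem Uone_nonneg [MeasurableSpace E] {μ : Measure E}
    (hq : ∀ j < n, ∀ x x', 0 ≤ q j x x') (hℓ : ℓ ≤ n) (x : E) :
    0 ≤ Uone μ n q ℓ x := by
  rw [Uone_eq_integral_chainWeight]
  exact integral_nonneg fun v => Finset.prod_nonneg fun i _ => hq _ (by omega) _ _

end Bounds

section Integrals

variable {E : Type*} [MeasurableSpace E] {μ : Measure E} [IsFiniteMeasure μ]
  {q : ℕ → E → E → ℝ} {n ℓ : ℕ} {a b : ℝ}

theorem measurable_Uone (hq : ∀ j, Measurable (Function.uncurry (q j))) :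
    Measurable (Uone μ n q ℓ) := by
  rw [funext (Uone_eq_integral_chainWeight μ n q ℓ)]
  exact (measurable_chainWeight hq (n - ℓ) ℓ).stronglyMeasurable.integral_prod_right.measurable

theorem integrable_chainWeight (hqm : ∀ j, Measurable (Function.uncurry (q j)))
    (hq : ∀ j < n, ∀ x x', 0 ≤ q j x x' ∧ q j x x' ≤ b) {m : ℕ} (hm : ℓ + m ≤ n) (x : E) :
    Integrable (chainWeight q m ℓ x) (Measure.pi fun _ => μ) := by
  refine Integrable.of_bound (C := b ^ m)
    ((measurable_chainWeight hqm m ℓ).comp measurable_prodMk_left).aestronglyMeasurable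
    (.of_forall fun v => ?_)
  rw [Real.norm_of_nonneg]
  · exact chainWeight_le_pow hq hm x v
  · exact Finset.prod_nonneg fun i _ => (hq _ (by omega) _ _).1

theorem Uone_pos (hμ : μ ≠ 0) (hqm : ∀ j, Measurable (Function.uncurry (q j))) (ha : 0 < a)
    (hq : ∀ j < n, ∀ x x', a ≤ q j x x' ∧ q j x x' ≤ b) (hℓ : ℓ ≤ n) (x : E) :
    0 < Uone μ n q ℓ x := by
  have hm : ℓ + (n - ℓ) ≤ n := by omega
  rw [Uone_eq_integral_chainWeight]
  refine lt_of_lt_of_le ?_ (integral_mono (integrable_const (a ^ (n - ℓ)))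
    (integrable_chainWeight hqm (fun j hj x x' => ⟨ha.le.trans (hq j hj x x').1, (hq j hj x x').2⟩)
      hm x) fun v => pow_le_chainWeight ha.le (fun j hj x x' => (hq j hj x x').1) hm x v)
  have hμ' : 0 < μ.real Set.univ := by
    have : NeZero μ := ⟨hμ⟩
    exact measureReal_univ_pos
  simp only [integral_const, smul_eq_mul, measureReal_def, Measure.pi_univ, Finset.prod_const,
    ENNReal.toReal_pow]
  exact mul_pos (pow_pos hμ' _) (pow_pos ha _)

theorem Uone_le (hqm : ∀ j, Measurable (Function.uncurry (q j)))
    (hq : ∀ j < n, ∀ x x', 0 ≤ q j x x' ∧ q j x x' ≤ b) (hℓ : ℓ ≤ n) (x : E) :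
    Uone μ n q ℓ x ≤ (b * μ.real Set.univ) ^ (n - ℓ) := by
  have hm : ℓ + (n - ℓ) ≤ n := by omega
  rw [Uone_eq_integral_chainWeight]
  refine (integral_mono (integrable_chainWeight hqm hq hm x) (integrable_const (b ^ (n - ℓ)))
    fun v => chainWeight_le_pow hq hm x v).trans_eq ?_
  simp [measureReal_def, Measure.pi_univ, mul_pow, mul_comm]

theorem Uone_eq_integral_mul_Uone_succ (hqm : ∀ j, Measurable (Function.uncurry (q j)))
    (hq : ∀ j < n, ∀ x x', 0 ≤ q j x x' ∧ q j x x' ≤ b) (hℓ : ℓ < n) (x : E) :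
    Uone μ n q ℓ x = ∫ y, q ℓ x y * Uone μ n q (ℓ + 1) y ∂μ := by
  simp only [Uone_eq_integral_chainWeight]
  obtain ⟨m, hm⟩ : ∃ m, n - ℓ = m + 1 := ⟨n - ℓ - 1, by omega⟩
  rw [hm, show n - (ℓ + 1) = m by omega]
  have hmp := (measurePreserving_piFinSuccAbove (fun _ : Fin (m + 1) => μ) 0).symm
  have hint := integrable_chainWeight (μ := μ) hqm hq (show ℓ + (m + 1) ≤ n by omega) x
  have hprod : Integrable (fun z => chainWeight q (m + 1) ℓ x
      ((MeasurableEquiv.piFinSuccAbove (fun _ : Fin (m + 1) => E) 0).symm z))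
      (μ.prod (Measure.pi fun _ => μ)) := hmp.integrable_comp_of_integrable hint
  rw [← hmp.integral_comp', integral_prod _ hprod]
  refine integral_congr_ae (.of_forall fun y => ?_)
  beta_reduce
  rw [← integral_const_mul]
  refine integral_congr_ae (.of_forall fun w => ?_)
  have hcons : (MeasurableEquiv.piFinSuccAbove (fun _ : Fin (m + 1) => E) 0).symm (y, w) =
      (Fin.cons y w : Fin (m + 1) → E) := Fin.insertNth_zero' y w
  beta_reduce
  rw [hcons, chainWeight_cons]

end Integrals

/-- Minorization of the forward smoothing kernels: under the two-sided bounds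
`σ₋ ≤ q_ℓ ≤ σ₊`, the forward kernel
`F_ℓ h(x) = (∫ q_ℓ(x, x') h(x') U_{ℓ+1,n}1(x') dμ(x')) / U_{ℓ,n}1(x)` satisfies
`F_ℓ h(x) ≥ (σ₋/σ₊) ν_ℓ h` for every nonnegative bounded measurable `h`, where
`ν_ℓ h = (∫ h U_{ℓ+1,n}1 dμ)/(∫ U_{ℓ+1,n}1 dμ)`. -/
theorem forward_kernel_minorization
    {E : Type*} [MeasurableSpace E] (μ : Measure E) [IsFiniteMeasure μ] (hμ : μ ≠ 0)
    (n : ℕ) (hn : 1 ≤ n)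
    (q : ℕ → E → E → ℝ) (hqmeas : ∀ j, Measurable (Function.uncurry (q j)))
    (σm σp : ℝ) (hσm : 0 < σm) (hσmp : σm ≤ σp)
    (hH2q : ∀ j < n, ∀ x x', σm ≤ q j x x' ∧ q j x x' ≤ σp) :
    ∀ ℓ < n, ∀ h : E → ℝ, Measurable h → (∀ x, 0 ≤ h x) → (∃ M, ∀ x, h x ≤ M) →
      ∀ x : E,
        (σm / σp) *
            ((∫ x', h x' * Uone μ n q (ℓ + 1) x' ∂μ) / ∫ x', Uone μ n q (ℓ + 1) x' ∂μ) ≤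
          (∫ x', q ℓ x x' * h x' * Uone μ n q (ℓ + 1) x' ∂μ) / Uone μ n q ℓ x := by
  intro ℓ hℓ h hm h0 ⟨M, hM⟩ x
  have hq0 : ∀ j < n, ∀ x x', 0 ≤ q j x x' ∧ q j x x' ≤ σp := fun j hj x x' =>
    ⟨hσm.le.trans (hH2q j hj x x').1, (hH2q j hj x x').2⟩
  have hU0 : ∀ y, 0 ≤ Uone μ n q (ℓ + 1) y :=
    Uone_nonneg (fun j hj x x' => (hq0 j hj x x').1) (by omega)
  have hUint : Integrable (Uone μ n q (ℓ + 1)) μ :=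
    Integrable.of_bound (measurable_Uone hqmeas).aestronglyMeasurable _ (.of_forall fun y => by
      rw [Real.norm_of_nonneg (hU0 y)]
      exact Uone_le hqmeas hq0 (by omega) y)
  have hhU : Integrable (fun y => h y * Uone μ n q (ℓ + 1) y) μ :=
    hUint.bdd_mul hm.aestronglyMeasurable (.of_forall fun y => by
      rw [Real.norm_of_nonneg (h0 y)]
      exact hM y)
  have hqx {g : E → ℝ} (hg : Integrable g μ) : Integrable (fun y => q ℓ x y * g y) μ :=
    hg.bdd_mul ((hqmeas ℓ).comp measurable_prodMk_left).aestronglyMeasurable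
      (.of_forall fun y => by
        change ‖q ℓ x y‖ ≤ σp
        rw [Real.norm_of_nonneg (hq0 ℓ hℓ x y).1]
        exact (hq0 ℓ hℓ x y).2)
  have hpos : 0 < Uone μ n q ℓ x := Uone_pos hμ hqmeas hσm hH2q hℓ.le x
  have hle : Uone μ n q ℓ x ≤ σp * ∫ y, Uone μ n q (ℓ + 1) y ∂μ := by
    rw [Uone_eq_integral_mul_Uone_succ hqmeas hq0 hℓ x, ← integral_const_mul]
    exact integral_mono (hqx hUint) (hUint.const_mul _) fun y =>
      mul_le_mul_of_nonneg_right (hq0 ℓ hℓ x y).2 (hU0 y)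
  have hA : 0 ≤ ∫ y, h y * Uone μ n q (ℓ + 1) y ∂μ :=
    integral_nonneg fun y => mul_nonneg (h0 y) (hU0 y)
  have hnum : σm * ∫ y, h y * Uone μ n q (ℓ + 1) y ∂μ ≤
      ∫ y, q ℓ x y * h y * Uone μ n q (ℓ + 1) y ∂μ := by
    simp only [mul_assoc]
    rw [← integral_const_mul]
    exact integral_mono (hhU.const_mul _) (hqx hhU) fun y =>
      mul_le_mul_of_nonneg_right (hH2q ℓ hℓ x y).1 (mul_nonneg (h0 y) (hU0 y))
  rw [div_mul_div_comm]
  exact div_le_div₀ ((mul_nonneg hσm.le hA).trans hnum) hnum hpos hle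
end

section
/- (Uniqueness of the instrumental densities achieving c_k = 0) Let n ≥ 1 and assume that for all k and x the denominators defining φ_k and B_{k−1} are positive. Suppose η_0, …, η_n are measurable probability densities on E such that: (i) ∫ h η_0 dμ = ∫ h φ_0 dμ for every bounded measurable h : E → ℝ; and (ii) for every 1 ≤ k ≤ n and every bounded measurable h : E × E → ℝ, ∫∫ h(x_{k−1}, x_k) η_k(x_k) B_{k−1}(x_k, x_{k−1}) dμ(x_{k−1}) dμ(x_k) = (∫∫ h(x, x') η_{k−1}(x) q_{k−1}(x, x') dμ(x) dμ(x')) / (∫∫ η_{k−1}(x) q_{k−1}(x, x') dμ(x) dμ(x')), where B_{k−1}(x_k, x_{k−1}) = m_{k−1}(x_{k−1}, x_k) φ_{k−1}(x_{k−1}) / ∫ m_{k−1}(x, x_k) φ_{k−1}(x) dμ(x) is the true backward density and q_{k−1}(x, x') = m_{k−1}(x, x') g_k(x'). Then η_k = φ_k μ-almost everywhere for every 0 ≤ k ≤ n; i.e. the true filtering densities are the unique sequence of instrumental densities achieving c_k = 0 for all k in hypothesis H1 when the variational kernels are the true backward kernels. -/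
open MeasureTheory Finset

/-- The filtering densities: `φ_0 = χ g_0 / ∫ χ g_0 dμ` and
`φ_{k+1}(x') = g_{k+1}(x') ∫ m_k(x, x') φ_k(x) dμ(x) / N_{k+1}`. -/
noncomputable def filt {E : Type*} [MeasurableSpace E] (μ : Measure E)
    (χ : E → ℝ) (g : ℕ → E → ℝ) (mtr : ℕ → E → E → ℝ) : ℕ → E → ℝ
  | 0 => fun x => χ x * g 0 x / ∫ y, χ y * g 0 y ∂μ
  | k + 1 => fun x' =>
      g (k + 1) x' * (∫ x, mtr k x x' * filt μ χ g mtr k x ∂μ) /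
        ∫ z, g (k + 1) z * ∫ x, mtr k x z * filt μ χ g mtr k x ∂μ ∂μ

/-- A weighted density times a family of conditional densities times a bounded function is
integrable with respect to the product measure. -/
lemma integrable_mul_transition_mul_bounded
    {E : Type*} [MeasurableSpace E] {μ : Measure E} [SigmaFinite μ]
    {p : E → ℝ} (hpmeas : Measurable p) (hpint : Integrable p μ)
    {m : E → E → ℝ} (hmmeas : Measurable (Function.uncurry m))
    (hmnn : ∀ x x', 0 ≤ m x x') (hmprob : ∀ x, ∫ x', m x x' ∂μ = 1)
    {f : E → ℝ} (hfmeas : Measurable f) {C : ℝ} (hf : ∀ x, |f x| ≤ C) :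
    Integrable (fun z : E × E => p z.1 * (m z.1 z.2 * f z.2)) (μ.prod μ) := by
  have hm : Measurable fun z : E × E => m z.1 z.2 := hmmeas
  have hpm : Integrable (fun z : E × E => p z.1 * m z.1 z.2) (μ.prod μ) := by
    have hmeas : Measurable fun z : E × E => p z.1 * m z.1 z.2 :=
      (hpmeas.comp measurable_fst).mul hm
    refine (integrable_prod_iff hmeas.aestronglyMeasurable).2 ⟨.of_forall fun x => ?_, ?_⟩
    · exact (integrable_of_integral_eq_one (hmprob x)).const_mul (p x)
    · simpa [abs_mul, abs_of_nonneg (hmnn _ _), integral_const_mul, hmprob] using hpint.abs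
  refine (hpm.mul_bdd (c := C) (hfmeas.comp measurable_snd).aestronglyMeasurable
    (.of_forall fun z => hf z.2)).congr (.of_forall fun z => ?_)
  simp only [Function.comp_apply]
  ring

/-- Two integrable functions with the same integrals against all bounded measurable functions
agree almost everywhere. -/
lemma ae_eq_of_forall_integral_bounded_mul_eq
    {E : Type*} [MeasurableSpace E] {μ : Measure E} {p q : E → ℝ}
    (hp : Integrable p μ) (hq : Integrable q μ)
    (h : ∀ f : E → ℝ, Measurable f → (∃ M, ∀ x, |f x| ≤ M) →
      ∫ x, f x * p x ∂μ = ∫ x, f x * q x ∂μ) :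
    p =ᵐ[μ] q := by
  refine hp.ae_eq_of_forall_setIntegral_eq p q hq fun s hs _ => ?_
  have key := h (s.indicator 1) (measurable_one.indicator hs) ⟨1, fun x => by
    by_cases hx : x ∈ s <;> simp [hx]⟩
  have hind (r : E → ℝ) : (fun x => s.indicator 1 x * r x) = s.indicator r := by
    ext x
    by_cases hx : x ∈ s <;> simp [hx]
  rwa [hind, hind, integral_indicator hs, integral_indicator hs] at key

/-- Uniqueness of the instrumental densities achieving `c_k = 0`: if `η_0, …, η_n` are
probability densities satisfying exactly (with zero error) the conditions of H1 relative to
the true backward kernels `B_{k-1}` and `q_{k-1}(x, x') = m_{k-1}(x, x') g_k(x')`, then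
`η_k = φ_k` `μ`-a.e. for every `k ≤ n`: the true filtering densities are the unique such
sequence. -/
theorem uniqueness_of_exact_instrumental_densities
    {E : Type*} [MeasurableSpace E] (μ : Measure E) [SigmaFinite μ]
    (χ : E → ℝ) (hχmeas : Measurable χ) (hχnn : ∀ x, 0 ≤ χ x) (hχprob : ∫ x, χ x ∂μ = 1)
    (mtr : ℕ → E → E → ℝ) (hmmeas : ∀ j, Measurable (Function.uncurry (mtr j)))
    (hmnn : ∀ j x x', 0 ≤ mtr j x x') (hmprob : ∀ j x, ∫ x', mtr j x x' ∂μ = 1)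
    (g : ℕ → E → ℝ) (hgmeas : ∀ j, Measurable (g j)) (hgnn : ∀ j x, 0 ≤ g j x)
    (gbd : ℕ → ℝ) (hgbd : ∀ j x, g j x ≤ gbd j)
    (n : ℕ) (hn : 1 ≤ n)
    -- the filtering normalizers are positive (hence finite)
    (hnorm0 : 0 < ∫ x, χ x * g 0 x ∂μ)
    (hnormj : ∀ j < n,
      0 < ∫ z, g (j + 1) z * ∫ x, mtr j x z * filt μ χ g mtr j x ∂μ ∂μ)
    (hfiltint : ∀ j < n, ∀ x',
      Integrable (fun x => mtr j x x' * filt μ χ g mtr j x) μ)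
    -- the backward-kernel denominators are positive at every point
    (hden : ∀ k, 1 ≤ k → k ≤ n → ∀ xk : E,
      0 < ∫ y, mtr (k - 1) y xk * filt μ χ g mtr (k - 1) y ∂μ)
    -- the instrumental densities η_k
    (η : ℕ → E → ℝ) (hηmeas : ∀ k, Measurable (η k)) (hηnn : ∀ k x, 0 ≤ η k x)
    (hηprob : ∀ k ≤ n, ∫ x, η k x ∂μ = 1)
    -- the normalizers `∫∫ η_{k-1} q_{k-1} dμ dμ` are positive (hence finite)
    (hηN : ∀ k, 1 ≤ k → k ≤ n →
      0 < ∫ x, ∫ x', η (k - 1) x * (mtr (k - 1) x x' * g k x') ∂μ ∂μ)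
    -- (i): exact matching at time 0
    (hexact0 : ∀ h : E → ℝ, Measurable h → (∃ M, ∀ x, |h x| ≤ M) →
      ∫ x, h x * η 0 x ∂μ = ∫ x, h x * filt μ χ g mtr 0 x ∂μ)
    -- (ii): exact matching of the one-step joint laws, with the true backward kernels
    (hexact : ∀ k, 1 ≤ k → k ≤ n →
      ∀ h : E → E → ℝ, Measurable (Function.uncurry h) → (∃ M, ∀ a b, |h a b| ≤ M) →
      (∫ xk, ∫ xkm1,
        h xkm1 xk * (η k xk *
          (mtr (k - 1) xkm1 xk * filt μ χ g mtr (k - 1) xkm1 /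
            ∫ y, mtr (k - 1) y xk * filt μ χ g mtr (k - 1) y ∂μ)) ∂μ ∂μ) =
      (∫ x, ∫ x',
        h x x' * (η (k - 1) x * (mtr (k - 1) x x' * g k x')) ∂μ ∂μ) /
        ∫ x, ∫ x', η (k - 1) x * (mtr (k - 1) x x' * g k x') ∂μ ∂μ) :
    ∀ k ≤ n, η k =ᵐ[μ] filt μ χ g mtr k := by
  have hηint (k : ℕ) (hk : k ≤ n) : Integrable (η k) μ :=
    integrable_of_integral_eq_one (hηprob k hk)
  intro k
  induction k with
  | zero =>
    intro hk
    refine ae_eq_of_forall_integral_bounded_mul_eq (hηint 0 hk) ?_ hexact0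
    exact (Integrable.of_integral_ne_zero hnorm0.ne').div_const _
  | succ k ih =>
    intro hk
    have hkn : k ≤ n := by omega
    have hae := ih hkn
    have hD (x' : E) : ∫ x, mtr k x x' * filt μ χ g mtr k x ∂μ =
        ∫ x, η k x * mtr k x x' ∂μ :=
      integral_congr_ae (hae.mono fun x hx => by simp only [← hx, mul_comm])
    have hswap (f : E → ℝ) (hf : Measurable f) (hfb : ∃ M, ∀ x, |f x| ≤ M) :
        ∫ x, ∫ x', f x' * (η k x * (mtr k x x' * g (k + 1) x')) ∂μ ∂μ =
          ∫ x', f x' * (g (k + 1) x' * ∫ x, mtr k x x' * filt μ χ g mtr k x ∂μ) ∂μ := by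
      obtain ⟨M, hM⟩ := hfb
      have hfg (x : E) : |f x * g (k + 1) x| ≤ M * gbd (k + 1) := by
        rw [abs_mul, abs_of_nonneg (hgnn _ _)]
        exact mul_le_mul (hM x) (hgbd _ x) (hgnn _ x) ((abs_nonneg _).trans (hM x))
      have hint := integrable_mul_transition_mul_bounded (hηmeas k) (hηint k hkn) (hmmeas k)
        (hmnn k) (hmprob k) (hf.mul (hgmeas (k + 1))) hfg
      calc ∫ x, ∫ x', f x' * (η k x * (mtr k x x' * g (k + 1) x')) ∂μ ∂μ
          = ∫ x, ∫ x', η k x * (mtr k x x' * (f x' * g (k + 1) x')) ∂μ ∂μ := by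
            congr! 4
            ring
        _ = ∫ x', ∫ x, η k x * (mtr k x x' * (f x' * g (k + 1) x')) ∂μ ∂μ :=
            integral_integral_swap hint
        _ = _ := by
            congr! 2 with x'
            rw [hD, ← mul_assoc, ← integral_const_mul]
            congr! 2
            ring
    have hN : ∫ x, ∫ x', η k x * (mtr k x x' * g (k + 1) x') ∂μ ∂μ =
        ∫ z, g (k + 1) z * ∫ x, mtr k x z * filt μ χ g mtr k x ∂μ ∂μ := by
      simpa using hswap (fun _ => 1) measurable_const ⟨1, by simp⟩
    refine ae_eq_of_forall_integral_bounded_mul_eq (hηint _ hk) ?_ fun f hf hfb => ?_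
    · exact (Integrable.of_integral_ne_zero (hnormj k hk).ne').div_const _
    · have key := hexact (k + 1) (by omega) hk (fun _ x' => f x') (hf.comp measurable_snd)
        (hfb.imp fun M hM _ x' => hM x')
      simp only [Nat.add_sub_cancel] at key
      rw [hswap f hf hfb, hN, ← integral_div] at key
      calc ∫ x, f x * η (k + 1) x ∂μ = _ := by
            congr! 2 with x'
            have hpos := hden (k + 1) (by omega) hk x'
            simp only [Nat.add_sub_cancel] at hpos
            rw [integral_const_mul, integral_const_mul, integral_div, div_self hpos.ne', mul_one]
        _ = _ := key
        _ = _ := by simp only [filt, mul_div_assoc]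
end
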